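/- Let m ≥ 0 be an integer and p > 1, p' = p/(p−1). Let K be a kernel on ℝⁿ×ℝⁿ (defined off the diagonal) such that: (a) |K(x,y)| ≤ C_K |x−y|^{−n} for x ≠ y; (b) |K(x,y)−K(x',y)| + |K(y,x)−K(y,x')| ≤ ω(|x−x'|/|x−y|)·|x−y|^{−n} whenever |x−y| > 2|x−x'|, where ω : [0,1] → [0,∞) satisfies ω(t) → 0 as t → 0; (c) there is c₀ > 0 such that for every y ∈ ℝⁿ and r > 0 there exists x ∉ B(y,r) with |K(x,y)| ≥ c₀ r^{−n}, and the same holds for the transposed kernel (x,y) ↦ K(y,x). Let u, v be weights on ℝⁿ with u doubling (u(2Q) ≤ c·u(Q) for every cube Q). Assume there is a constant C such that for every b ∈ BMO and every bounded compactly supported f, the function x ↦ ∫_{ℝⁿ} (b(x)−b(y))^m K(x,y) f(y) dy (which is well defined for x outside the closed support of f) satisfies ‖χ_{ℝⁿ∖supp f} · ∫(b(·)−b(y))^m K(·,y)f(y)dy‖_{L^{p,∞}(u)} ≤ C·‖b‖_{BMO}^m·‖f‖_{L^p(v)}. Then sup over all cubes Q of ‖u^{1/p}‖_{L^p,Q}·‖v^{−1/p}‖_{L^{p'}(log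 L)^{mp'},Q} is finite. -/

import Mathlib

open MeasureTheory ENNReal Filter

noncomputable section

/-- A (half-open) cube in `ℝⁿ`. -/
structure Cube (n : ℕ) where
  corner : Fin n → ℝ
  side : ℝ
  side_pos : 0 < side

/-- The underlying set of a cube. -/
def Cube.set {n : ℕ} (Q : Cube n) : Set (Fin n → ℝ) :=
  Set.univ.pi fun i => Set.Ico (Q.corner i) (Q.corner i + Q.side)

/-- A weight: a non-negative, locally integrable function. -/
def IsWeight {n : ℕ} (w : (Fin n → ℝ) → ℝ) : Prop :=
  Measurable w ∧ (∀ x, 0 ≤ w x) ∧ LocallyIntegrable w volume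

/-- A sparse family of cubes with sparseness constant `α`. -/
def IsSparse {n : ℕ} (S : Set (Cube n)) (α : ℝ) : Prop :=
  ∃ E : Cube n → Set (Fin n → ℝ),
    (∀ Q ∈ S, E Q ⊆ Q.set ∧ MeasurableSet (E Q) ∧
      ENNReal.ofReal α * volume Q.set ≤ volume (E Q)) ∧
    S.Pairwise fun Q Q' => Disjoint (E Q) (E Q')

/-- The normalized Luxemburg norm `‖f‖_{φ,Q}` (with value `∞` if no λ works). -/
def luxNorm {n : ℕ} (φ : ℝ → ℝ) (Q : Set (Fin n → ℝ)) (f : (Fin n → ℝ) → ℝ) : ℝ≥0∞ :=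
  sInf {l : ℝ≥0∞ | ∃ c : ℝ, 0 < c ∧ l = ENNReal.ofReal c ∧
    (∫⁻ x in Q, ENNReal.ofReal (φ (|f x| / c))) ≤ volume Q}

/-- The sparse Orlicz operator `A_{L(log L)^m, S}`. -/
def sparseOrlicz {n : ℕ} (m : ℕ) (S : Set (Cube n)) (f : (Fin n → ℝ) → ℝ)
    (x : Fin n → ℝ) : ℝ≥0∞ :=
  ∑' Q : S, luxNorm (fun t => t * Real.log (Real.exp 1 + t) ^ m) Q.1.set f *
    Set.indicator Q.1.set (fun _ => (1 : ℝ≥0∞)) x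

/-- `L^p(w)` norm of an `ℝ≥0∞`-valued function. -/
def lpNormW {n : ℕ} (p : ℝ) (w : (Fin n → ℝ) → ℝ) (g : (Fin n → ℝ) → ℝ≥0∞) : ℝ≥0∞ :=
  (∫⁻ x, g x ^ p * ENNReal.ofReal (w x)) ^ (1 / p)

/-- `L^p(w)` norm of a real-valued function. -/
def lpNormR {n : ℕ} (p : ℝ) (w f : (Fin n → ℝ) → ℝ) : ℝ≥0∞ :=
  (∫⁻ x, ENNReal.ofReal |f x| ^ p * ENNReal.ofReal (w x)) ^ (1 / p)

/-- The two-weight bump constant `[g,h]_{A,B}`. -/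
def bump {n : ℕ} (A B : ℝ → ℝ) (g h : (Fin n → ℝ) → ℝ) : ℝ≥0∞ :=
  ⨆ Q : Cube n, luxNorm A Q.set g * luxNorm B Q.set h

/-- The logarithmic-bump Young function `t ↦ t^q (log(e+t))^a`. -/
def phiLog (q a : ℝ) : ℝ → ℝ := fun t => t ^ q * Real.log (Real.exp 1 + t) ^ a
/-- The size condition for a Calderón–Zygmund kernel. -/
def KernelSize {n : ℕ} (K : (Fin n → ℝ) → (Fin n → ℝ) → ℝ) (CK : ℝ) : Prop :=
  ∀ x y : Fin n → ℝ, x ≠ y → |K x y| ≤ CK / dist x y ^ n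

/-- The smoothness condition for a Calderón–Zygmund kernel with modulus `ω`. -/
def KernelSmooth {n : ℕ} (K : (Fin n → ℝ) → (Fin n → ℝ) → ℝ) (ω : ℝ → ℝ) : Prop :=
  ∀ x x' y : Fin n → ℝ, 2 * dist x x' < dist x y →
    |K x y - K x' y| + |K y x - K y x'| ≤ ω (dist x x' / dist x y) / dist x y ^ n

/-- Non-degeneracy of a kernel. -/
def KernelNonDeg {n : ℕ} (K : (Fin n → ℝ) → (Fin n → ℝ) → ℝ) (c₀ : ℝ) : Prop :=
  ∀ (y : Fin n → ℝ) (r : ℝ), 0 < r →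
    ∃ x : Fin n → ℝ, x ∉ Metric.ball y r ∧ c₀ / r ^ n ≤ |K x y|

/-- Average of a function over a cube. -/
def cubeAvg {n : ℕ} (f : (Fin n → ℝ) → ℝ) (Q : Cube n) : ℝ :=
  (∫ x in Q.set, f x) / (volume Q.set).toReal

/-- The `BMO` norm. -/
def bmoNorm {n : ℕ} (b : (Fin n → ℝ) → ℝ) : ℝ≥0∞ :=
  ⨆ Q : Cube n, (∫⁻ x in Q.set, ENNReal.ofReal |b x - cubeAvg b Q|) / volume Q.set

/-- The weighted `BMO_η` norm. -/
def bmoWNorm {n : ℕ} (η b : (Fin n → ℝ) → ℝ) : ℝ≥0∞ :=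
  ⨆ Q : Cube n, (∫⁻ x in Q.set, ENNReal.ofReal |b x - cubeAvg b Q|) /
    (∫⁻ x in Q.set, ENNReal.ofReal (η x))

/-- The `m`-th iterated commutator of the operator with kernel `K` and of `b`,
given by an absolutely convergent integral off the support of `f`. -/
def commFn {n : ℕ} (m : ℕ) (K : (Fin n → ℝ) → (Fin n → ℝ) → ℝ)
    (b f : (Fin n → ℝ) → ℝ) (x : Fin n → ℝ) : ℝ :=
  ∫ y, (b x - b y) ^ m * K x y * f y

/-- The double `2Q` of a cube: concentric with twice the side length. -/
def Cube.double {n : ℕ} (Q : Cube n) : Cube n :=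
  ⟨fun i => Q.corner i - Q.side / 2, 2 * Q.side, by have := Q.side_pos; linarith⟩

/-- A doubling weight: `u(2Q) ≤ c·u(Q)` for all cubes `Q`. -/
def IsDoublingWeight {n : ℕ} (u : (Fin n → ℝ) → ℝ) : Prop :=
  ∃ c : ℝ, ∀ Q : Cube n,
    (∫⁻ x in Q.double.set, ENNReal.ofReal (u x)) ≤
      ENNReal.ofReal c * ∫⁻ x in Q.set, ENNReal.ofReal (u x)

/-- The weak `L^{p,∞}(u)` norm. -/
def weakLpNorm {n : ℕ} (p : ℝ) (u : (Fin n → ℝ) → ℝ) (g : (Fin n → ℝ) → ℝ) : ℝ≥0∞ :=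
  ⨆ (t : ℝ) (_ : 0 < t),
    ENNReal.ofReal t * (∫⁻ x in {x | t < |g x|}, ENNReal.ofReal (u x)) ^ (1 / p)

/-- The uncentred Hardy–Littlewood maximal function over balls of the sup metric. -/
def maxFn {n : ℕ} (F : (Fin n → ℝ) → ℝ≥0∞) (x : Fin n → ℝ) : ℝ≥0∞ :=
  ⨆ (z : Fin n → ℝ) (r : ℝ) (_ : x ∈ Metric.ball z r),
    (∫⁻ y in Metric.closedBall z r, F y) / volume (Metric.closedBall z r)

theorem lt_maxFn_iff {n : ℕ} {F : (Fin n → ℝ) → ℝ≥0∞} {x : Fin n → ℝ} {t : ℝ≥0∞} :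
    t < maxFn F x ↔ ∃ (z : Fin n → ℝ) (r : ℝ), x ∈ Metric.ball z r ∧
      t < (∫⁻ y in Metric.closedBall z r, F y) / volume (Metric.closedBall z r) := by
  simp only [maxFn, lt_iSup_iff, exists_prop]

theorem le_maxFn {n : ℕ} {F : (Fin n → ℝ) → ℝ≥0∞} {x z : Fin n → ℝ} {r : ℝ}
    (hx : x ∈ Metric.ball z r) :
    (∫⁻ y in Metric.closedBall z r, F y) / volume (Metric.closedBall z r) ≤ maxFn F x :=
  le_iSup_of_le z (le_iSup_of_le r (le_iSup_of_le hx le_rfl))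

theorem maxFn_le {n : ℕ} {F : (Fin n → ℝ) → ℝ≥0∞} {x : Fin n → ℝ} {t : ℝ≥0∞}
    (h : ∀ (z : Fin n → ℝ) (r : ℝ), x ∈ Metric.ball z r →
      (∫⁻ y in Metric.closedBall z r, F y) / volume (Metric.closedBall z r) ≤ t) :
    maxFn F x ≤ t :=
  iSup_le fun z => iSup_le fun r => iSup_le fun hx => h z r hx

theorem volume_closedBall_pi {n : ℕ} (z : Fin n → ℝ) {r : ℝ} (hr : 0 ≤ r) :
    volume (Metric.closedBall z r) = ENNReal.ofReal ((2 * r) ^ n) := by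
  rw [Real.volume_pi_closedBall z hr, Fintype.card_fin]

theorem volume_closedBall_pi_ne_zero {n : ℕ} (z : Fin n → ℝ) {r : ℝ} (hr : 0 < r) :
    volume (Metric.closedBall z r) ≠ 0 := by
  rw [volume_closedBall_pi z hr.le]
  simp only [ne_eq, ENNReal.ofReal_eq_zero, not_le]
  positivity

theorem volume_closedBall_pi_ne_top {n : ℕ} (z : Fin n → ℝ) (r : ℝ) :
    volume (Metric.closedBall z r) ≠ ⊤ :=
  (isCompact_closedBall z r).measure_lt_top.ne

theorem measurable_maxFn {n : ℕ} (F : (Fin n → ℝ) → ℝ≥0∞) : Measurable (maxFn F) := by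
  apply measurable_of_Ioi
  intro t
  have : maxFn F ⁻¹' Set.Ioi t = ⋃ (z : Fin n → ℝ) (r : ℝ)
      (_ : t < (∫⁻ y in Metric.closedBall z r, F y) / volume (Metric.closedBall z r)),
      Metric.ball z r := by
    ext x
    simp only [Set.mem_preimage, Set.mem_Ioi, lt_maxFn_iff, Set.mem_iUnion, exists_prop]
    constructor
    · rintro ⟨z, r, h1, h2⟩; exact ⟨z, r, h2, h1⟩
    · rintro ⟨z, r, h1, h2⟩; exact ⟨z, r, h2, h1⟩
  rw [this]
  exact (isOpen_iUnion fun z => isOpen_iUnion fun r => isOpen_iUnion fun _ =>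
    Metric.isOpen_ball).measurableSet

theorem setLAverage_le_of_le {n : ℕ} {F : (Fin n → ℝ) → ℝ≥0∞} {N : ℝ≥0∞}
    (hF : ∀ x, F x ≤ N) (s : Set (Fin n → ℝ)) :
    (∫⁻ y in s, F y) / volume s ≤ N := by
  apply ENNReal.div_le_of_le_mul
  calc ∫⁻ y in s, F y ≤ ∫⁻ _ in s, N := lintegral_mono fun y => hF y
    _ = N * volume s := by simp

theorem maxFn_le_of_le {n : ℕ} {F : (Fin n → ℝ) → ℝ≥0∞} {N : ℝ≥0∞}
    (hF : ∀ x, F x ≤ N) (x : Fin n → ℝ) : maxFn F x ≤ N :=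
  maxFn_le fun _ _ _ => setLAverage_le_of_le hF _

/-- The maximal function is of weak type `(1,1)`. -/
theorem volume_lt_maxFn_le {n : ℕ} (hn : n ≠ 0) {F : (Fin n → ℝ) → ℝ≥0∞}
    (hF : ∫⁻ y, F y ≠ ⊤) {t : ℝ≥0∞} (ht : t ≠ 0) (ht' : t ≠ ⊤) :
    t * volume {x | t < maxFn F x} ≤ 4 ^ n * ∫⁻ y, F y := by
  let T : Set ((Fin n → ℝ) × ℝ) := {a | 0 < a.2 ∧
    t < (∫⁻ y in Metric.closedBall a.1 a.2, F y) / volume (Metric.closedBall a.1 a.2)}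
  have hvol : ∀ a ∈ T, t * volume (Metric.closedBall a.1 a.2) ≤
      ∫⁻ y in Metric.closedBall a.1 a.2, F y := by
    intro a ha
    exact ENNReal.mul_le_of_le_div ha.2.le
  have hR : ∀ a ∈ T, a.2 ≤ max 1 ((∫⁻ y, F y) / t).toReal := by
    intro a ha
    by_contra! hcon
    have h1 : volume (Metric.closedBall a.1 a.2) ≤ (∫⁻ y, F y) / t := by
      rw [ENNReal.le_div_iff_mul_le (Or.inl ht) (Or.inl ht'), mul_comm]
      exact (hvol a ha).trans (setLIntegral_le_lintegral _ _)
    rw [volume_closedBall_pi _ ha.1.le,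
      ENNReal.ofReal_le_iff_le_toReal (ENNReal.div_ne_top hF ht)] at h1
    have h2 : 2 * a.2 ≤ (2 * a.2) ^ n :=
      le_self_pow₀ (by linarith [le_max_left 1 ((∫⁻ y, F y) / t).toReal]) hn
    linarith [le_max_right 1 ((∫⁻ y, F y) / t).toReal, ha.1]
  obtain ⟨U, hUT, hdisj, hcov⟩ := Vitali.exists_disjoint_subfamily_covering_enlargement_closedBall
    T (fun a => a.1) (fun a => a.2) _ hR 4 (by norm_num)
  have hUc : U.Countable := by
    refine hdisj.countable_of_nonempty_interior fun a ha => ?_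
    exact ⟨a.1, Metric.ball_subset_interior_closedBall
      (Metric.mem_ball_self (hUT ha).1)⟩
  have hsub : {x | t < maxFn F x} ⊆ ⋃ b ∈ U, Metric.closedBall b.1 (4 * b.2) := by
    intro x hx
    obtain ⟨z, r, hxz, hlt⟩ := lt_maxFn_iff.1 hx
    have hr : 0 < r := dist_nonneg.trans_lt (Metric.mem_ball.1 hxz)
    obtain ⟨b, hb, hsubb⟩ := hcov (z, r) ⟨hr, hlt⟩
    exact Set.mem_biUnion hb (hsubb (Metric.ball_subset_closedBall hxz))
  have hfour : ∀ b ∈ U, volume (Metric.closedBall b.1 (4 * b.2)) =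
      4 ^ n * volume (Metric.closedBall b.1 b.2) := by
    intro b hb
    have h0 := (hUT hb).1
    rw [volume_closedBall_pi _ (by linarith), volume_closedBall_pi _ h0.le,
      show (2 * (4 * b.2)) ^ n = 4 ^ n * (2 * b.2) ^ n by rw [← mul_pow]; ring,
      ENNReal.ofReal_mul (by positivity), ENNReal.ofReal_pow (by norm_num)]
    norm_num
  have := hUc.to_subtype
  calc t * volume {x | t < maxFn F x}
      ≤ t * ∑' b : U, volume (Metric.closedBall b.1.1 (4 * b.1.2)) := by
        gcongr
        exact (measure_mono hsub).trans (measure_biUnion_le _ hUc _)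
    _ = ∑' b : U, 4 ^ n * (t * volume (Metric.closedBall b.1.1 b.1.2)) := by
        rw [← ENNReal.tsum_mul_left]
        congr 1; ext b
        rw [hfour b.1 b.2]; ring
    _ ≤ ∑' b : U, 4 ^ n * ∫⁻ y in Metric.closedBall b.1.1 b.1.2, F y := by
        gcongr with b
        exact hvol b.1 (hUT b.2)
    _ = 4 ^ n * ∫⁻ y in ⋃ b ∈ U, Metric.closedBall b.1 b.2, F y := by
        rw [ENNReal.tsum_mul_left, lintegral_biUnion hUc
          (fun b _ => Metric.isClosed_closedBall.measurableSet) hdisj]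
    _ ≤ 4 ^ n * ∫⁻ y, F y := by
        gcongr
        exact Measure.restrict_le_self

theorem ae_le_maxFn {n : ℕ} {F : (Fin n → ℝ) → ℝ≥0∞} (hFm : Measurable F)
    (hF : ∫⁻ y, F y ≠ ⊤) : ∀ᵐ x, F x ≤ maxFn F x := by
  filter_upwards [(Besicovitch.vitaliFamily (volume : Measure (Fin n → ℝ))).ae_tendsto_lintegral_div'
    hFm hF] with x hx
  refine le_of_tendsto (hx.comp (Besicovitch.tendsto_filterAt volume x)) ?_
  filter_upwards [self_mem_nhdsWithin] with r hr
  exact le_maxFn (Metric.mem_ball_self hr)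

/-- The centre of a cube. -/
def Cube.center {n : ℕ} (Q : Cube n) : Fin n → ℝ := fun i => Q.corner i + Q.side / 2

theorem Cube.volume_set {n : ℕ} (Q : Cube n) :
    volume Q.set = ENNReal.ofReal (Q.side ^ n) := by
  have := Q.side_pos
  rw [Cube.set, Real.volume_pi_Ico]
  simp [ENNReal.ofReal_pow this.le]

theorem Cube.volume_set_ne_zero {n : ℕ} (Q : Cube n) : volume Q.set ≠ 0 := by
  have := Q.side_pos
  rw [Q.volume_set]
  simp only [ne_eq, ENNReal.ofReal_eq_zero, not_le]
  positivity

theorem Cube.volume_set_ne_top {n : ℕ} (Q : Cube n) : volume Q.set ≠ ⊤ := by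
  rw [Q.volume_set]; exact ENNReal.ofReal_ne_top

theorem Cube.measurableSet_set {n : ℕ} (Q : Cube n) : MeasurableSet Q.set :=
  MeasurableSet.univ_pi fun _ => measurableSet_Ico

theorem Cube.set_subset_closedBall {n : ℕ} (Q : Cube n) :
    Q.set ⊆ Metric.closedBall Q.center (Q.side / 2) := by
  intro x hx
  have := Q.side_pos
  rw [Metric.mem_closedBall, dist_pi_le_iff (by linarith)]
  intro i
  have h := hx i (Set.mem_univ i)
  rw [Real.dist_eq, abs_le, Cube.center]
  constructor <;> linarith [h.1, h.2]

/-- The oscillation around any constants controls the `BMO` norm. -/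
theorem bmoNorm_le_of_forall_exists {n : ℕ} {b : (Fin n → ℝ) → ℝ}
    (hb : LocallyIntegrable b volume) {D : ℝ≥0∞}
    (h : ∀ Q : Cube n, ∃ c : ℝ,
      ∫⁻ x in Q.set, ENNReal.ofReal |b x - c| ≤ D * volume Q.set) :
    bmoNorm b ≤ 2 * D := by
  refine iSup_le fun Q => ?_
  obtain ⟨c, hc⟩ := h Q
  apply ENNReal.div_le_of_le_mul
  have hbQ : IntegrableOn b Q.set volume :=
    (hb.integrableOn_isCompact (isCompact_closedBall Q.center (Q.side / 2))).mono_set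
      Q.set_subset_closedBall
  have hV : 0 < (volume Q.set).toReal :=
    ENNReal.toReal_pos Q.volume_set_ne_zero Q.volume_set_ne_top
  have havg : (c - cubeAvg b Q) * (volume Q.set).toReal = ∫ x in Q.set, (c - b x) := by
    have hint : ∫ x in Q.set, (c - b x) = (∫ _ in Q.set, c) - ∫ x in Q.set, b x :=
      integral_sub (integrableOn_const Q.volume_set_ne_top) hbQ
    rw [hint, cubeAvg, sub_mul, div_mul_cancel₀ _ hV.ne', setIntegral_const, smul_eq_mul,
      mul_comm c, measureReal_def]
  have hosc : ENNReal.ofReal |c - cubeAvg b Q| * volume Q.set ≤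
      ∫⁻ x in Q.set, ENNReal.ofReal |b x - c| := by
    calc ENNReal.ofReal |c - cubeAvg b Q| * volume Q.set
        = ENNReal.ofReal |∫ x in Q.set, (c - b x)| := by
          rw [← havg, abs_mul, abs_of_pos hV, ENNReal.ofReal_mul (abs_nonneg _),
            ENNReal.ofReal_toReal Q.volume_set_ne_top]
      _ = ‖∫ x in Q.set, (c - b x)‖ₑ := by
          rw [← Real.norm_eq_abs, ofReal_norm]
      _ ≤ ∫⁻ x in Q.set, ‖c - b x‖ₑ := enorm_integral_le_lintegral_enorm _
      _ = _ := by
          congr 1; ext x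
          rw [← ofReal_norm, Real.norm_eq_abs, abs_sub_comm]
  calc ∫⁻ x in Q.set, ENNReal.ofReal |b x - cubeAvg b Q|
      ≤ ∫⁻ x in Q.set, (ENNReal.ofReal |b x - c| + ENNReal.ofReal |c - cubeAvg b Q|) := by
        refine lintegral_mono fun x => ?_
        rw [← ENNReal.ofReal_add (abs_nonneg _) (abs_nonneg _)]
        exact ENNReal.ofReal_le_ofReal (abs_sub_le _ _ _)
    _ = (∫⁻ x in Q.set, ENNReal.ofReal |b x - c|) +
          ENNReal.ofReal |c - cubeAvg b Q| * volume Q.set := by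
        rw [lintegral_add_right _ measurable_const, setLIntegral_const]
    _ ≤ D * volume Q.set + D * volume Q.set := add_le_add hc (hosc.trans hc)
    _ = 2 * D * volume Q.set := by ring

theorem log_max_one_le_sum (K : ℕ) {t : ℝ} (ht : t ≤ 2 ^ K) :
    Real.log (max 1 t) ≤ ∑ k ∈ Finset.range K, if (2 : ℝ) ^ k < t then 1 else 0 := by
  induction K with
  | zero => simp at ht; simp [ht]
  | succ K ih =>
    rw [Finset.sum_range_succ]
    by_cases h : (2 : ℝ) ^ K < t
    · have h1 : (1 : ℝ) ≤ 2 ^ K := one_le_pow₀ (by norm_num)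
      have hall : ∑ k ∈ Finset.range K, (if (2 : ℝ) ^ k < t then (1 : ℝ) else 0) = K := by
        rw [Finset.sum_congr rfl (g := fun _ => (1 : ℝ))]
        · simp
        · intro k hk
          rw [if_pos]
          exact (pow_le_pow_right₀ (by norm_num) (Finset.mem_range.1 hk).le).trans_lt h
      rw [hall, if_pos h, max_eq_right (h1.trans h.le)]
      calc Real.log t ≤ Real.log (2 ^ (K + 1)) := Real.log_le_log (by linarith) ht
        _ = (K + 1) * Real.log 2 := by rw [Real.log_pow]; push_cast; ring
        _ ≤ (K + 1) * 1 := by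
          gcongr
          linarith [Real.log_two_lt_d9]
        _ = _ := by ring
    · rw [if_neg h, add_zero]
      exact ih (not_lt.1 h)

theorem lintegral_log_max_one_le {n : ℕ} {G : (Fin n → ℝ) → ℝ≥0∞} (hG : Measurable G)
    (hGt : ∀ x, G x ≠ ⊤) {D : ℝ≥0∞} (h : ∀ k : ℕ, 2 ^ k * volume {x | 2 ^ k < G x} ≤ D) :
    ∫⁻ x, ENNReal.ofReal (Real.log (max 1 (G x).toReal)) ≤ 2 * D := by
  have hms : ∀ k : ℕ, MeasurableSet {x | 2 ^ k < G x} := fun k => hG measurableSet_Ioi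
  calc ∫⁻ x, ENNReal.ofReal (Real.log (max 1 (G x).toReal))
      ≤ ∫⁻ x, ∑' k : ℕ, Set.indicator {x | 2 ^ k < G x} (fun _ => (1 : ℝ≥0∞)) x := by
        refine lintegral_mono fun x => ?_
        obtain ⟨K, hK⟩ := pow_unbounded_of_one_lt (G x).toReal (one_lt_two (α := ℝ))
        refine le_trans (ENNReal.ofReal_le_ofReal (log_max_one_le_sum K hK.le)) ?_
        refine le_trans ?_ (ENNReal.sum_le_tsum (Finset.range K))
        rw [ENNReal.ofReal_sum_of_nonneg (fun k _ => by split_ifs <;> norm_num)]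
        refine Finset.sum_le_sum fun k _ => ?_
        have hiff : (2 : ℝ) ^ k < (G x).toReal ↔ 2 ^ k < G x := by
          rw [← ENNReal.ofReal_lt_iff_lt_toReal (by positivity) (hGt x),
            ENNReal.ofReal_pow (by norm_num)]
          norm_num
        by_cases hk : 2 ^ k < G x
        · simp [hiff, hk]
        · simp [hiff, hk]
    _ = ∑' k : ℕ, volume {x | 2 ^ k < G x} := by
        rw [lintegral_tsum fun k => (measurable_const.indicator (hms k)).aemeasurable]
        congr 1; ext k
        rw [lintegral_indicator (hms k)]; simp
    _ ≤ ∑' k : ℕ, (2⁻¹ : ℝ≥0∞) ^ k * D := by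
        refine ENNReal.tsum_le_tsum fun k => ?_
        rw [← ENNReal.inv_pow, mul_comm, ← div_eq_mul_inv,
          ENNReal.le_div_iff_mul_le (Or.inl (by simp)) (Or.inl (by simp)), mul_comm]
        exact h k
    _ = 2 * D := by
        rw [ENNReal.tsum_mul_right, ENNReal.tsum_geometric, ENNReal.one_sub_inv_two, inv_inv]

/-- Absolute bound for the `BMO` norm of a truncated logarithm of a maximal function. -/
def logMaxConst (n : ℕ) : ℝ≥0∞ := 2 * (ENNReal.ofReal (n * Real.log 2) + 2 * 24 ^ n)

theorem logMaxConst_ne_top (n : ℕ) : logMaxConst n ≠ ⊤ := by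
  unfold logMaxConst
  finiteness

theorem measurable_log_maxFn {n : ℕ} (F : (Fin n → ℝ) → ℝ≥0∞) :
    Measurable fun x => Real.log (max 1 (maxFn F x).toReal) :=
  (measurable_const.max (measurable_maxFn F).ennreal_toReal).log

theorem log_maxFn_nonneg {n : ℕ} (F : (Fin n → ℝ) → ℝ≥0∞) (x : Fin n → ℝ) :
    0 ≤ Real.log (max 1 (maxFn F x).toReal) := Real.log_nonneg (le_max_left _ _)

theorem log_maxFn_le {n : ℕ} {F : (Fin n → ℝ) → ℝ≥0∞} {N : ℝ≥0∞} (hN : N ≠ ⊤)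
    (hF : ∀ x, F x ≤ N) (x : Fin n → ℝ) :
    Real.log (max 1 (maxFn F x).toReal) ≤ Real.log (max 1 N.toReal) :=
  Real.log_le_log (by positivity)
    (max_le_max le_rfl (ENNReal.toReal_mono hN (maxFn_le_of_le hF x)))

theorem locallyIntegrable_log_maxFn {n : ℕ} {F : (Fin n → ℝ) → ℝ≥0∞} {N : ℝ≥0∞} (hN : N ≠ ⊤)
    (hF : ∀ x, F x ≤ N) :
    LocallyIntegrable (fun x => Real.log (max 1 (maxFn F x).toReal)) volume := by
  refine (locallyIntegrable_const (Real.log (max 1 N.toReal))).mono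
    (measurable_log_maxFn F).aestronglyMeasurable (ae_of_all _ fun x => ?_)
  rw [Real.norm_of_nonneg (log_maxFn_nonneg F x)]
  exact (log_maxFn_le hN hF x).trans (le_abs_self _)

/-- On a cube the maximal function is at most a local part plus a constant comparable to it. -/
theorem maxFn_le_max_local {n : ℕ} {F : (Fin n → ℝ) → ℝ≥0∞} (P : Cube n) {a : ℝ≥0∞}
    (ha : ∀ (z : Fin n → ℝ) (r : ℝ), P.set ⊆ Metric.ball z r →
      (∫⁻ y in Metric.closedBall z r, F y) / volume (Metric.closedBall z r) ≤ a)
    {x : Fin n → ℝ} (hx : x ∈ P.set) :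
    maxFn F x ≤ max
      (maxFn ((Metric.closedBall P.center (3 * P.side)).indicator F) x) (2 ^ n * a) := by
  have hh := P.side_pos
  have hxc := Metric.mem_closedBall.1 (P.set_subset_closedBall hx)
  refine maxFn_le fun z r hxz => ?_
  have hr : 0 < r := dist_nonneg.trans_lt (Metric.mem_ball.1 hxz)
  rw [Metric.mem_ball] at hxz
  by_cases hrh : r ≤ P.side
  · refine le_trans (le_of_eq ?_) (le_max_of_le_left (le_maxFn (Metric.mem_ball.2 hxz)))
    congr 1
    refine setLIntegral_congr_fun Metric.isClosed_closedBall.measurableSet fun y hy => ?_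
    rw [Set.indicator_of_mem]
    rw [Metric.mem_closedBall] at hy ⊢
    linarith [dist_triangle y z P.center, dist_triangle z x P.center, dist_comm z x]
  · refine le_max_of_le_right ?_
    have hsub : P.set ⊆ Metric.ball z (2 * r) := by
      intro q hq
      have hqc := Metric.mem_closedBall.1 (P.set_subset_closedBall hq)
      rw [Metric.mem_ball]
      linarith [dist_triangle q P.center z, dist_triangle P.center x z, dist_comm P.center x]
    have hv : volume (Metric.closedBall z (2 * r)) = 2 ^ n * volume (Metric.closedBall z r) := by
      rw [volume_closedBall_pi _ (by linarith), volume_closedBall_pi _ hr.le,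
        mul_pow 2 (2 * r), ENNReal.ofReal_mul (by positivity), ENNReal.ofReal_pow (by norm_num)]
      norm_num
    apply ENNReal.div_le_of_le_mul
    calc ∫⁻ y in Metric.closedBall z r, F y ≤ ∫⁻ y in Metric.closedBall z (2 * r), F y :=
          lintegral_mono_set (Metric.closedBall_subset_closedBall (by linarith))
      _ ≤ a * volume (Metric.closedBall z (2 * r)) :=
          (ENNReal.div_le_iff_le_mul
            (Or.inl (volume_closedBall_pi_ne_zero z (by linarith)))
            (Or.inl (volume_closedBall_pi_ne_top z _))).1 (ha z _ hsub)
      _ = 2 ^ n * a * volume (Metric.closedBall z r) := by rw [hv]; ring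

theorem bmoNorm_log_maxFn_le {n : ℕ} (hn : n ≠ 0) {F : (Fin n → ℝ) → ℝ≥0∞}
    {N : ℝ≥0∞} (hN : N ≠ ⊤) (hF : ∀ x, F x ≤ N) :
    bmoNorm (fun x => Real.log (max 1 (maxFn F x).toReal)) ≤ logMaxConst n := by
  refine bmoNorm_le_of_forall_exists (locallyIntegrable_log_maxFn hN hF) fun P => ?_
  have hh := P.side_pos
  set a₀ : ℝ≥0∞ := ⨆ (z : Fin n → ℝ) (r : ℝ) (_ : P.set ⊆ Metric.ball z r),
    (∫⁻ y in Metric.closedBall z r, F y) / volume (Metric.closedBall z r) with ha₀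
  have ha : ∀ (z : Fin n → ℝ) (r : ℝ), P.set ⊆ Metric.ball z r →
      (∫⁻ y in Metric.closedBall z r, F y) / volume (Metric.closedBall z r) ≤ a₀ := by
    intro z r h
    exact le_iSup_of_le z (le_iSup_of_le r (le_iSup_of_le h le_rfl))
  set a : ℝ≥0∞ := max 1 a₀ with ha_def
  have ha1 : 1 ≤ a := le_max_left _ _
  have ha' : ∀ (z : Fin n → ℝ) (r : ℝ), P.set ⊆ Metric.ball z r →
      (∫⁻ y in Metric.closedBall z r, F y) / volume (Metric.closedBall z r) ≤ a :=
    fun z r h => (ha z r h).trans (le_max_right _ _)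
  have ha₀N : a₀ ≤ N :=
    iSup_le fun z => iSup_le fun r => iSup_le fun _ => setLAverage_le_of_le hF _
  have hatop : a ≠ ⊤ := (max_lt ENNReal.one_lt_top (ha₀N.trans_lt hN.lt_top)).ne
  have ha0 : a ≠ 0 := (zero_lt_one.trans_le ha1).ne'
  set F₁ := (Metric.closedBall P.center (3 * P.side)).indicator F with hF₁
  have hF₁N : ∀ x, F₁ x ≤ N := fun x => (Set.indicator_le_self _ _ x).trans (hF x)
  have hF₁int : ∫⁻ y, F₁ y ≤ a * ENNReal.ofReal ((6 * P.side) ^ n) := by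
    rw [hF₁, lintegral_indicator Metric.isClosed_closedBall.measurableSet]
    have hsub : P.set ⊆ Metric.ball P.center (3 * P.side) :=
      P.set_subset_closedBall.trans (Metric.closedBall_subset_ball (by linarith))
    have h := (ENNReal.div_le_iff_le_mul
            (Or.inl (volume_closedBall_pi_ne_zero P.center (by linarith)))
            (Or.inl (volume_closedBall_pi_ne_top P.center _))).1 (ha' _ _ hsub)
    rwa [volume_closedBall_pi _ (by linarith), ← mul_assoc,
      show (2 : ℝ) * 3 = 6 by norm_num] at h
  have hF₁top : ∫⁻ y, F₁ y ≠ ⊤ :=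
    (hF₁int.trans_lt (ENNReal.mul_lt_top hatop.lt_top ENNReal.ofReal_lt_top)).ne
  set G : (Fin n → ℝ) → ℝ≥0∞ := fun x => maxFn F₁ x / a with hG
  have hM₁top : ∀ x, maxFn F₁ x ≠ ⊤ := fun x =>
    ((maxFn_le_of_le hF₁N x).trans_lt hN.lt_top).ne
  have hGlog : ∫⁻ x, ENNReal.ofReal (Real.log (max 1 (G x).toReal)) ≤
      2 * (24 ^ n * volume P.set) := by
    refine lintegral_log_max_one_le ((measurable_maxFn F₁).div_const a)
      (fun x => ENNReal.div_ne_top (hM₁top x) ha0) fun k => ?_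
    have hset : {x | 2 ^ k < G x} = {x | 2 ^ k * a < maxFn F₁ x} := by
      ext x
      simp only [hG, Set.mem_ofPred_eq]
      rw [ENNReal.lt_div_iff_mul_lt (Or.inl ha0) (Or.inl hatop)]
    have hw := volume_lt_maxFn_le hn hF₁top (t := 2 ^ k * a)
      (mul_ne_zero (by simp) ha0) (ENNReal.mul_ne_top (by simp) hatop)
    rw [hset, ← ENNReal.mul_le_mul_iff_right ha0 hatop]
    calc a * (2 ^ k * volume {x | 2 ^ k * a < maxFn F₁ x})
        = 2 ^ k * a * volume {x | 2 ^ k * a < maxFn F₁ x} := by ring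
      _ ≤ 4 ^ n * (a * ENNReal.ofReal ((6 * P.side) ^ n)) := hw.trans (by gcongr)
      _ = a * (24 ^ n * volume P.set) := by
        rw [P.volume_set, mul_pow, ENNReal.ofReal_mul (by positivity),
          ENNReal.ofReal_pow (by norm_num), show (24 : ℝ≥0∞) = 4 * 6 by norm_num, mul_pow]
        norm_num
        ring
  refine ⟨Real.log a.toReal, ?_⟩
  have hA1 : 1 ≤ a.toReal := by
    rw [← ENNReal.toReal_one]; exact ENNReal.toReal_mono hatop ha1
  have hpt : ∀ x ∈ P.set, ENNReal.ofReal
      |Real.log (max 1 (maxFn F x).toReal) - Real.log a.toReal| ≤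
      ENNReal.ofReal (n * Real.log 2) + ENNReal.ofReal (Real.log (max 1 (G x).toReal)) := by
    intro x hx
    have hMtop : maxFn F x ≠ ⊤ := ((maxFn_le_of_le hF x).trans_lt hN.lt_top).ne
    have hlow : a.toReal ≤ max 1 (maxFn F x).toReal := by
      rw [← ENNReal.toReal_one, ← ENNReal.toReal_max ENNReal.one_ne_top hMtop]
      refine ENNReal.toReal_mono (max_lt ENNReal.one_lt_top hMtop.lt_top).ne
        (max_le_max le_rfl ?_)
      exact iSup_le fun z => iSup_le fun r => iSup_le fun h => le_maxFn (h hx)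
    have hpow1 : (1 : ℝ) ≤ 2 ^ n := one_le_pow₀ (by norm_num)
    have hup : max 1 (maxFn F x).toReal ≤ a.toReal * (2 ^ n * max 1 (G x).toReal) := by
      have hone : 1 ≤ 2 ^ n * max 1 (G x).toReal :=
        one_le_mul_of_one_le_of_one_le hpow1 (le_max_left _ _)
      refine max_le (one_le_mul_of_one_le_of_one_le hA1 hone) ?_
      have h := ENNReal.toReal_mono
        (max_lt (hM₁top x).lt_top (ENNReal.mul_lt_top (by simp) hatop.lt_top)).ne
        (maxFn_le_max_local P ha' hx)
      rw [ENNReal.toReal_max (hM₁top x) (ENNReal.mul_ne_top (by simp) hatop)] at h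
      refine h.trans (max_le ?_ ?_)
      · have hg : (maxFn F₁ x).toReal = a.toReal * (G x).toReal := by
          rw [hG, ← ENNReal.toReal_mul, ENNReal.mul_div_cancel ha0 hatop]
        rw [hg]
        gcongr
        calc (G x).toReal ≤ 1 * max 1 (G x).toReal := by simp
          _ ≤ 2 ^ n * max 1 (G x).toReal := by gcongr
      · rw [ENNReal.toReal_mul, mul_comm]
        simp only [ENNReal.toReal_pow, ENNReal.toReal_ofNat]
        gcongr
        exact le_mul_of_one_le_right (by positivity) (le_max_left _ _)
    have hg1 : (0 : ℝ) < max 1 (G x).toReal := by positivity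
    rw [← ENNReal.ofReal_add (by positivity) (Real.log_nonneg (le_max_left _ _))]
    apply ENNReal.ofReal_le_ofReal
    have h1 := Real.log_le_log (by linarith) hlow
    have h2 := Real.log_le_log (by positivity) hup
    rw [Real.log_mul (by linarith) (by positivity), Real.log_mul (by positivity) hg1.ne',
      Real.log_pow] at h2
    rw [abs_of_nonneg (by linarith)]
    linarith
  calc ∫⁻ x in P.set, ENNReal.ofReal
        |Real.log (max 1 (maxFn F x).toReal) - Real.log a.toReal|
      ≤ ∫⁻ x in P.set, (ENNReal.ofReal (n * Real.log 2) +
          ENNReal.ofReal (Real.log (max 1 (G x).toReal))) :=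
        setLIntegral_mono' P.measurableSet_set hpt
    _ = ENNReal.ofReal (n * Real.log 2) * volume P.set +
          ∫⁻ x in P.set, ENNReal.ofReal (Real.log (max 1 (G x).toReal)) := by
        rw [lintegral_add_left measurable_const, setLIntegral_const]
    _ ≤ ENNReal.ofReal (n * Real.log 2) * volume P.set + 2 * (24 ^ n * volume P.set) := by
        gcongr
        exact (setLIntegral_le_lintegral _ _).trans hGlog
    _ = (ENNReal.ofReal (n * Real.log 2) + 2 * 24 ^ n) * volume P.set := by ring

/-- Kernel increments are small at relatively small displacements. -/
theorem kernel_sub_le {n : ℕ} {K : (Fin n → ℝ) → (Fin n → ℝ) → ℝ} {ω : ℝ → ℝ}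
    (hsmooth : KernelSmooth K ω) {η δ : ℝ} (hη : 0 ≤ η)
    (hδ : ∀ t, 0 < t → t < δ → ω t ≤ η) {x x' y : Fin n → ℝ} {ρ : ℝ} (hρ : 0 < ρ)
    (hxy : ρ ≤ dist x y) (h2 : 2 * dist x x' < dist x y) (h1 : dist x x' < δ * dist x y) :
    |K x y - K x' y| + |K y x - K y x'| ≤ η / ρ ^ n := by
  rcases eq_or_ne x x' with rfl | hne
  · simp only [sub_self, abs_zero, add_zero]
    positivity
  · have hd : 0 < dist x y := hρ.trans_le hxy
    refine (hsmooth x x' y h2).trans ?_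
    have hω := hδ (dist x x' / dist x y) (div_pos (dist_pos.2 hne) hd) ((div_lt_iff₀ hd).2 h1)
    gcongr

theorem exists_modulus_le {ω : ℝ → ℝ} (hωlim : Tendsto ω (nhdsWithin 0 (Set.Ioi 0)) (nhds 0))
    {η : ℝ} (hη : 0 < η) : ∃ δ > 0, ∀ t, 0 < t → t < δ → ω t ≤ η := by
  have h := hωlim.eventually (Iio_mem_nhds hη)
  rw [eventually_nhdsWithin_iff, Metric.eventually_nhds_iff] at h
  obtain ⟨δ, hδ, h⟩ := h
  refine ⟨δ, hδ, fun t ht htδ => (h ?_ ht).le⟩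
  rwa [Real.dist_eq, sub_zero, abs_of_pos ht]

theorem continuousOn_kernel {n : ℕ} {K : (Fin n → ℝ) → (Fin n → ℝ) → ℝ} {ω : ℝ → ℝ}
    (hωlim : Tendsto ω (nhdsWithin 0 (Set.Ioi 0)) (nhds 0))
    (hsmooth : KernelSmooth K ω) (x : Fin n → ℝ) : ContinuousOn (K x) {x}ᶜ := by
  intro y hy
  apply ContinuousAt.continuousWithinAt
  have hd : 0 < dist y x := dist_pos.2 hy
  rw [Metric.continuousAt_iff]
  intro e he
  have hη : 0 < e / 2 * dist y x ^ n := by positivity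
  obtain ⟨δ, hδ, h⟩ := exists_modulus_le hωlim hη
  refine ⟨min (dist y x / 2) (δ * dist y x), by positivity, fun y' hy' => ?_⟩
  rw [lt_min_iff, dist_comm] at hy'
  have hk := kernel_sub_le hsmooth hη.le h hd le_rfl (x' := y') (by linarith [hy'.1]) hy'.2
  rw [mul_div_cancel_right₀ _ (by positivity)] at hk
  rw [Real.dist_eq, abs_sub_comm]
  linarith [abs_nonneg (K y x - K y' x)]

/-- Nondegeneracy propagates to nearby points: every ball has a comparable ball, as far away as
prescribed, such that the kernel has constant sign and is large on their product. -/
theorem exists_kernel_lower_bound {n : ℕ} (hn : n ≠ 0)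
    {K : (Fin n → ℝ) → (Fin n → ℝ) → ℝ} {CK : ℝ} (hsize : KernelSize K CK)
    {ω : ℝ → ℝ} (hωlim : Tendsto ω (nhdsWithin 0 (Set.Ioi 0)) (nhds 0))
    (hsmooth : KernelSmooth K ω) {c₀ : ℝ} (hc₀ : 0 < c₀) (hnd : KernelNonDeg K c₀) (A₀ : ℝ) :
    ∃ κ > 0, ∃ R : ℝ, ∀ (y₀ : Fin n → ℝ) (l : ℝ), 0 < l → ∃ x₀ : Fin n → ℝ,
      A₀ * l ≤ dist x₀ y₀ ∧ dist x₀ y₀ ≤ R * l ∧ ∃ ε : ℝ, |ε| = 1 ∧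
        ∀ x ∈ Metric.closedBall x₀ (l / 2), ∀ y ∈ Metric.closedBall y₀ (l / 2),
          κ / l ^ n ≤ ε * K x y := by
  have hη : 0 < c₀ / 2 / (1 + 2 ^ n) := by positivity
  obtain ⟨δ, hδ, hω⟩ := exists_modulus_le hωlim hη
  set η := c₀ / 2 / (1 + 2 ^ n) with hη_def
  set A := max (max A₀ 4) (2 / δ) with hA_def
  have hA4 : 4 ≤ A := (le_max_right A₀ 4).trans (le_max_left _ _)
  have hAA₀ : A₀ ≤ A := (le_max_left A₀ 4).trans (le_max_left _ _)
  have hAδ : 2 ≤ δ * A := by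
    have : 2 / δ ≤ A := le_max_right _ _
    rw [div_le_iff₀ hδ] at this
    linarith
  have hA : 0 < A := by linarith
  refine ⟨c₀ / 2 / A ^ n, by positivity, max 1 (CK / c₀) * A, fun y₀ l hl => ?_⟩
  obtain ⟨x₀, hx₀, hK₀⟩ := hnd y₀ (A * l) (by positivity)
  rw [Metric.mem_ball, not_lt] at hx₀
  have hAl : 0 < A * l := by positivity
  have hd : 0 < dist x₀ y₀ := hAl.trans_le hx₀
  refine ⟨x₀, (mul_le_mul_of_nonneg_right hAA₀ hl.le).trans hx₀, ?_, ?_⟩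
  · have h := hK₀.trans (hsize x₀ y₀ (dist_pos.1 hd))
    rw [div_le_div_iff₀ (by positivity) (by positivity)] at h
    by_contra! hcon
    rw [mul_assoc] at hcon
    set κ := max 1 (CK / c₀)
    have hκ1 : 1 ≤ κ := le_max_left _ _
    have hκ : CK ≤ κ * c₀ := (div_le_iff₀ hc₀).1 (le_max_right _ _)
    have h1 : (κ * (A * l)) ^ n < dist x₀ y₀ ^ n := pow_lt_pow_left₀ hcon (by positivity) hn
    have h2 : κ * (A * l) ^ n ≤ (κ * (A * l)) ^ n := by
      rw [mul_pow κ]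
      exact mul_le_mul_of_nonneg_right (le_self_pow₀ hκ1 hn) (by positivity)
    have h3 : CK * (A * l) ^ n ≤ κ * c₀ * (A * l) ^ n := by gcongr
    nlinarith
  · have hosc : ∀ x ∈ Metric.closedBall x₀ (l / 2), ∀ y ∈ Metric.closedBall y₀ (l / 2),
        |K x y - K x₀ y₀| ≤ c₀ / 2 / (A * l) ^ n := by
      intro x hx y hy
      rw [Metric.mem_closedBall] at hx hy
      have h4l : 4 * l ≤ A * l := by gcongr
      have hδl : 2 * l ≤ δ * (A * l) := by rw [← mul_assoc]; gcongr
      have h1 := kernel_sub_le hsmooth hη.le hω hAl hx₀ (x' := x)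
        (by rw [dist_comm x₀ x]; linarith)
        (by
          rw [dist_comm x₀ x]
          have : δ * (A * l) ≤ δ * dist x₀ y₀ := by gcongr
          linarith)
      have hyx : A * l / 2 ≤ dist y₀ x := by
        have := dist_triangle x₀ x y₀
        rw [dist_comm x₀ x, dist_comm x y₀] at this
        linarith
      have h2 := kernel_sub_le hsmooth hη.le hω (half_pos hAl) hyx (x' := y)
        (by rw [dist_comm y₀ y]; linarith)
        (by
          rw [dist_comm y₀ y]
          have : δ * (A * l / 2) ≤ δ * dist y₀ x := by gcongr
          linarith)
      have hsum : η / (A * l) ^ n + η / (A * l / 2) ^ n = c₀ / 2 / (A * l) ^ n := by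
        rw [hη_def, div_pow]
        field_simp
      rw [← hsum]
      have h3 : |K x y - K x₀ y₀| ≤ |K x₀ y₀ - K x y₀| + |K x y₀ - K x y| := by
        rw [abs_sub_comm]
        exact abs_sub_le _ _ _
      linarith [abs_nonneg (K y₀ x₀ - K y₀ x), abs_nonneg (K y₀ x - K y x)]
    have hκ : c₀ / 2 / A ^ n / l ^ n = c₀ / 2 / (A * l) ^ n := by
      rw [div_div, mul_pow]
    have hhalf : c₀ / (A * l) ^ n = c₀ / 2 / (A * l) ^ n + c₀ / 2 / (A * l) ^ n := by ring
    rw [hκ]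
    rcases le_total 0 (K x₀ y₀) with h0 | h0
    · refine ⟨1, by simp, fun x hx y hy => ?_⟩
      rw [abs_of_nonneg h0] at hK₀
      linarith [(abs_le.1 (hosc x hx y hy)).1]
    · refine ⟨-1, by simp, fun x hx y hy => ?_⟩
      rw [abs_of_nonpos h0] at hK₀
      linarith [(abs_le.1 (hosc x hx y hy)).2]

/-- The cube with given centre and side. -/
def Cube.ofCenter {n : ℕ} (z : Fin n → ℝ) (l : ℝ) (hl : 0 < l) : Cube n :=
  ⟨fun i => z i - l / 2, l, hl⟩

theorem Cube.center_ofCenter {n : ℕ} (z : Fin n → ℝ) (l : ℝ) (hl : 0 < l) :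
    (Cube.ofCenter z l hl).center = z := by
  ext i; simp [Cube.ofCenter, Cube.center]

theorem Cube.ball_subset_set {n : ℕ} (Q : Cube n) :
    Metric.ball Q.center (Q.side / 2) ⊆ Q.set := by
  intro x hx i _
  have := Q.side_pos
  rw [Metric.mem_ball, dist_pi_lt_iff (by linarith)] at hx
  have h := abs_lt.1 (hx i)
  simp only [Cube.center] at h
  constructor <;> linarith [h.1, h.2]

theorem Cube.iterate_double {n : ℕ} (Q : Cube n) (k : ℕ) :
    (Cube.double^[k] Q).center = Q.center ∧ (Cube.double^[k] Q).side = 2 ^ k * Q.side := by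
  induction k with
  | zero => simp
  | succ k ih =>
    rw [Function.iterate_succ_apply']
    constructor
    · rw [← ih.1]
      ext i
      simp only [Cube.center, Cube.double]
      ring
    · simp only [Cube.double, ih.2]
      ring

/-- A doubling weight has comparable mass on cubes of equal side at comparable distance. -/
theorem IsDoublingWeight.exists_le {n : ℕ} {u : (Fin n → ℝ) → ℝ} (hu : IsDoublingWeight u)
    (R : ℝ) : ∃ D : ℝ, 0 < D ∧ ∀ Q Q' : Cube n, Q.side = Q'.side →
      dist Q'.center Q.center ≤ R * Q.side →
      ∫⁻ x in Q.set, ENNReal.ofReal (u x) ≤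
        ENNReal.ofReal D * ∫⁻ x in Q'.set, ENNReal.ofReal (u x) := by
  obtain ⟨c, hc⟩ := hu
  obtain ⟨k, hk⟩ := pow_unbounded_of_one_lt (2 * R + 1) (one_lt_two (α := ℝ))
  refine ⟨max c 1 ^ k, by positivity, fun Q Q' hs hd => ?_⟩
  have hside := Q.side_pos
  have hiter : ∀ j : ℕ, ∫⁻ x in (Cube.double^[j] Q').set, ENNReal.ofReal (u x) ≤
      ENNReal.ofReal (max c 1 ^ j) * ∫⁻ x in Q'.set, ENNReal.ofReal (u x) := by
    intro j
    induction j with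
    | zero => simp
    | succ j ih =>
      rw [Function.iterate_succ_apply', pow_succ', ENNReal.ofReal_mul (by positivity), mul_assoc]
      refine (hc _).trans ?_
      gcongr
      exact le_max_left _ _
  refine (lintegral_mono_set ?_).trans (hiter k)
  refine Q.set_subset_closedBall.trans (Set.Subset.trans ?_ (Cube.ball_subset_set _))
  rw [(Q'.iterate_double k).1, (Q'.iterate_double k).2, ← hs]
  apply Metric.closedBall_subset_ball'
  rw [dist_comm]
  nlinarith

theorem integrableOn_cube_of_bounded {n : ℕ} (Q : Cube n) {f : (Fin n → ℝ) → ℝ}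
    (hf : Measurable f) (hf0 : ∀ x, 0 ≤ f x) {M : ℝ} (hM : ∀ x, f x ≤ M) :
    IntegrableOn f Q.set volume := by
  have : IsFiniteMeasure (volume.restrict Q.set) := ⟨by
    rw [Measure.restrict_apply_univ]; exact Q.volume_set_ne_top.lt_top⟩
  exact Integrable.of_bound hf.aestronglyMeasurable M (ae_of_all _ fun y => by
    rw [Real.norm_of_nonneg (hf0 y)]; exact hM y)

/-- Off-support lower bound for a commutator whose symbol vanishes at the evaluation point. -/
theorem le_abs_commFn {n m : ℕ} {K : (Fin n → ℝ) → (Fin n → ℝ) → ℝ} {x : Fin n → ℝ}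
    (hcont : ContinuousOn (K x) {x}ᶜ) {Q : Cube n}
    (hx : x ∉ Metric.closedBall Q.center (Q.side / 2)) {ε κ : ℝ} (hε : |ε| = 1)
    (hK : ∀ y ∈ Metric.closedBall Q.center (Q.side / 2), κ ≤ ε * K x y)
    {b g : (Fin n → ℝ) → ℝ} (hbx : b x = 0) (hb0 : ∀ y, 0 ≤ b y) (hbm : Measurable b)
    (hgm : Measurable g) (hg0 : ∀ y, 0 ≤ g y) {H : ℝ} (hH : ∀ y, b y ^ m * g y ≤ H) :
    κ * ∫ y in Q.set, b y ^ m * g y ≤ |commFn m K b (Q.set.indicator g) x| := by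
  have hKint : IntegrableOn (K x) Q.set volume := by
    refine IntegrableOn.mono_set ?_ Q.set_subset_closedBall
    refine ContinuousOn.integrableOn_compact (isCompact_closedBall _ _) (hcont.mono ?_)
    intro y hy hyx
    rw [Set.mem_singleton_iff] at hyx
    exact hx (hyx ▸ hy)
  have hhm : Measurable fun y => b y ^ m * g y := (hbm.pow_const m).mul hgm
  have hh0 : ∀ y, 0 ≤ b y ^ m * g y := fun y => mul_nonneg (pow_nonneg (hb0 y) m) (hg0 y)
  have hbdd : ∀ᵐ y ∂(volume.restrict Q.set), ‖b y ^ m * g y‖ ≤ H := ae_of_all _ fun y => by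
    rw [Real.norm_of_nonneg (hh0 y)]; exact hH y
  have hprod : Integrable (fun y => (b y ^ m * g y) * K x y) (volume.restrict Q.set) :=
    hKint.bdd_mul hhm.aestronglyMeasurable hbdd
  have hhint : Integrable (fun y => b y ^ m * g y) (volume.restrict Q.set) :=
    integrableOn_cube_of_bounded Q hhm hh0 hH
  have hcomm : commFn m K b (Q.set.indicator g) x =
      (-1) ^ m * ∫ y in Q.set, (b y ^ m * g y) * K x y := by
    rw [commFn, ← integral_const_mul, ← integral_indicator Q.measurableSet_set]
    congr 1; ext y
    by_cases hy : y ∈ Q.set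
    · simp only [Set.indicator_of_mem hy, hbx, zero_sub, neg_pow (b y)]
      ring
    · simp [Set.indicator_of_notMem hy]
  calc κ * ∫ y in Q.set, b y ^ m * g y = ∫ y in Q.set, κ * (b y ^ m * g y) :=
        (integral_const_mul _ _).symm
    _ ≤ ∫ y in Q.set, ε * ((b y ^ m * g y) * K x y) := by
        refine setIntegral_mono_on (hhint.const_mul κ) (hprod.const_mul ε) Q.measurableSet_set ?_
        intro y hy
        have := mul_le_mul_of_nonneg_left (hK y (Q.set_subset_closedBall hy)) (hh0 y)
        linarith
    _ = ε * ∫ y in Q.set, (b y ^ m * g y) * K x y := integral_const_mul _ _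
    _ ≤ |ε * ∫ y in Q.set, (b y ^ m * g y) * K x y| := le_abs_self _
    _ = |commFn m K b (Q.set.indicator g) x| := by
        rw [hcomm, abs_mul, abs_mul, abs_pow, hε]; simp

theorem tsupport_indicator_subset {n : ℕ} (Q : Cube n) (g : (Fin n → ℝ) → ℝ) :
    tsupport (Q.set.indicator g) ⊆ Metric.closedBall Q.center (Q.side / 2) :=
  closure_minimal (Set.support_indicator_subset.trans Q.set_subset_closedBall)
    Metric.isClosed_closedBall

theorem le_weakLpNorm_commFn {n m : ℕ} {p : ℝ} (hp : 1 < p)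
    {K : (Fin n → ℝ) → (Fin n → ℝ) → ℝ}
    (hcont : ∀ x, ContinuousOn (K x) {x}ᶜ) {Q Q' : Cube n}
    (hdisj : ∀ x ∈ Q'.set, x ∉ Metric.closedBall Q.center (Q.side / 2))
    {ε κ : ℝ} (hκ : 0 < κ) (hε : |ε| = 1)
    (hK : ∀ x ∈ Q'.set, ∀ y ∈ Metric.closedBall Q.center (Q.side / 2), κ ≤ ε * K x y)
    {b g : (Fin n → ℝ) → ℝ} (hbx : ∀ x ∈ Q'.set, b x = 0) (hb0 : ∀ y, 0 ≤ b y)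
    (hbm : Measurable b) (hgm : Measurable g) (hg0 : ∀ y, 0 ≤ g y) {H : ℝ}
    (hH : ∀ y, b y ^ m * g y ≤ H) (hI : 0 < ∫ y in Q.set, b y ^ m * g y)
    (u : (Fin n → ℝ) → ℝ) :
    ENNReal.ofReal (κ / 2 * ∫ y in Q.set, b y ^ m * g y) *
        (∫⁻ x in Q'.set, ENNReal.ofReal (u x)) ^ (1 / p) ≤
      weakLpNorm p u ((tsupport (Q.set.indicator g))ᶜ.indicator
        (commFn m K b (Q.set.indicator g))) := by
  refine le_iSup₂_of_le (κ / 2 * ∫ y in Q.set, b y ^ m * g y) (by positivity) ?_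
  gcongr
  intro x hx
  have hxQ := hdisj x hx
  have h := le_abs_commFn (hcont x) hxQ hε (hK x hx) (hbx x hx) hb0 hbm hgm hg0 hH
  have hlt : κ / 2 * ∫ y in Q.set, b y ^ m * g y < κ * ∫ y in Q.set, b y ^ m * g y := by
    gcongr
    linarith
  have hmem : x ∈ (tsupport (Q.set.indicator g))ᶜ :=
    fun hc => hxQ (tsupport_indicator_subset Q g hc)
  rw [Set.mem_ofPred_eq, Set.indicator_of_mem hmem]
  exact hlt.trans_le h

/-- For every bounded function on `Q` there is a logarithmic symbol of absolutely bounded `BMO`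
norm, at least one and dominating the logarithm of the function on `Q`, and zero far away. -/
theorem exists_log_symbol {n : ℕ} (hn : n ≠ 0) (Q : Cube n) {σ : (Fin n → ℝ) → ℝ}
    (hσm : Measurable σ) (hσ0 : ∀ x, 0 ≤ σ x) {N : ℝ} (hσN : ∀ x, σ x ≤ N)
    (hpos : 0 < ∫ x in Q.set, σ x) :
    ∃ (b : (Fin n → ℝ) → ℝ) (lam : ℝ), 0 < lam ∧
      lam * Q.side ^ n ≤ ∫ x in Q.set, σ x ∧
      Measurable b ∧ (∀ x, 0 ≤ b x) ∧ (∃ M, ∀ x, b x ≤ M) ∧ LocallyIntegrable b volume ∧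
      bmoNorm b ≤ logMaxConst n ∧ (∀ x ∈ Q.set, 1 ≤ b x) ∧
      (∀ᵐ x, x ∈ Q.set → Real.log (σ x / lam) ≤ b x) ∧
      ∀ x, (1 / 2 + Real.exp 1 * 2 ^ n) * Q.side ≤ dist x Q.center → b x = 0 := by
  have hl := Q.side_pos
  set I := ∫ x in Q.set, σ x with hI
  have he : 0 < Real.exp 1 := Real.exp_pos 1
  have he1 : 1 < Real.exp 1 := by simp
  have h2n : (1 : ℝ) ≤ 2 ^ n := one_le_pow₀ (by norm_num)
  set lam := I / (Real.exp 1 * 2 ^ n * Q.side ^ n) with hlam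
  have hlam0 : 0 < lam := by positivity
  set F : (Fin n → ℝ) → ℝ≥0∞ := Q.set.indicator fun x => ENNReal.ofReal (σ x / lam) with hF
  have hFm : Measurable F :=
    (hσm.div_const lam).ennreal_ofReal.indicator Q.measurableSet_set
  have hFN : ∀ x, F x ≤ ENNReal.ofReal (N / lam) := fun x =>
    (Set.indicator_le_self _ _ x).trans
      (ENNReal.ofReal_le_ofReal (by gcongr; exact hσN x))
  have hσint := integrableOn_cube_of_bounded Q hσm hσ0 hσN
  have hFint : ∫⁻ x, F x = ENNReal.ofReal (Real.exp 1 * (2 * Q.side) ^ n) := by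
    rw [hF, lintegral_indicator Q.measurableSet_set,
      ← ofReal_integral_eq_lintegral_ofReal (hσint.div_const lam)
        (ae_of_all _ fun x => div_nonneg (hσ0 x) hlam0.le), integral_div, ← hI, hlam]
    congr 1
    rw [mul_pow]
    field_simp
  have hFtop : ∫⁻ x, F x ≠ ⊤ := by rw [hFint]; exact ENNReal.ofReal_ne_top
  have hMtop : ∀ x, maxFn F x ≠ ⊤ := fun x =>
    ((maxFn_le_of_le hFN x).trans_lt ENNReal.ofReal_lt_top).ne
  refine ⟨fun x => Real.log (max 1 (maxFn F x).toReal), lam, hlam0, ?_, measurable_log_maxFn F,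
    log_maxFn_nonneg F, ⟨_, log_maxFn_le ENNReal.ofReal_ne_top hFN⟩,
    locallyIntegrable_log_maxFn ENNReal.ofReal_ne_top hFN,
    bmoNorm_log_maxFn_le hn ENNReal.ofReal_ne_top hFN, fun x hx => ?_, ?_, fun x hx => ?_⟩
  · rw [hlam, div_mul_eq_mul_div, div_le_iff₀ (by positivity)]
    have : 1 ≤ Real.exp 1 * 2 ^ n := one_le_mul_of_one_le_of_one_le he1.le h2n
    have h3 : 0 < I * Q.side ^ n := by positivity
    nlinarith
  · have hsub : Q.set ⊆ Metric.ball Q.center Q.side :=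
      Q.set_subset_closedBall.trans (Metric.closedBall_subset_ball (by linarith))
    have h := le_maxFn (F := F) (hsub hx)
    rw [setLIntegral_eq_of_support_subset, hFint, volume_closedBall_pi _ hl.le,
      ← ENNReal.ofReal_div_of_pos (by positivity), mul_div_cancel_right₀ _ (by positivity),
      ENNReal.ofReal_le_iff_le_toReal (hMtop x)] at h
    · rw [Real.le_log_iff_exp_le (by positivity)]
      exact h.trans (le_max_right _ _)
    · exact (Set.support_indicator_subset.trans hsub).trans Metric.ball_subset_closedBall
  · filter_upwards [ae_le_maxFn hFm hFtop] with x hx hxQ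
    rw [hF, Set.indicator_of_mem hxQ, ← hF, ENNReal.ofReal_le_iff_le_toReal (hMtop x)] at hx
    rcases (div_nonneg (hσ0 x) hlam0.le).eq_or_lt with h0 | h0
    · rw [← h0, Real.log_zero]
      exact log_maxFn_nonneg F x
    · exact Real.log_le_log h0 (hx.trans (le_max_right _ _))
  · have hM1 : maxFn F x ≤ 1 := by
      refine maxFn_le fun z r hxz => ?_
      have hr : 0 < r := dist_nonneg.trans_lt (Metric.mem_ball.1 hxz)
      by_cases hne : ∃ q ∈ Metric.closedBall z r, q ∈ Q.set
      · obtain ⟨q, hqz, hq⟩ := hne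
        have hqc := Q.set_subset_closedBall hq
        rw [Metric.mem_closedBall] at hqz hqc
        rw [Metric.mem_ball] at hxz
        have h2r : Real.exp 1 * 2 ^ n * Q.side ≤ 2 * r := by
          linarith [dist_triangle x z Q.center, dist_triangle z q Q.center, dist_comm z q]
        apply ENNReal.div_le_of_le_mul
        rw [one_mul, volume_closedBall_pi _ hr.le]
        refine (setLIntegral_le_lintegral _ _).trans ?_
        rw [hFint]
        apply ENNReal.ofReal_le_ofReal
        calc Real.exp 1 * (2 * Q.side) ^ n
            = (Real.exp 1 * 2 ^ n) * Q.side ^ n := by rw [mul_pow]; ring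
          _ ≤ (Real.exp 1 * 2 ^ n) ^ n * Q.side ^ n := by
              gcongr
              exact le_self_pow₀ (one_le_mul_of_one_le_of_one_le he1.le h2n) hn
          _ = (Real.exp 1 * 2 ^ n * Q.side) ^ n := (mul_pow _ _ _).symm
          _ ≤ (2 * r) ^ n := by gcongr
      · push Not at hne
        have h0 : ∫⁻ y in Metric.closedBall z r, F y = 0 := by
          rw [setLIntegral_congr_fun (g := fun _ => 0) Metric.isClosed_closedBall.measurableSet]
          · simp
          · intro y hy
            exact Set.indicator_of_notMem (hne y hy) _
        rw [h0]; simp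
    have : (maxFn F x).toReal ≤ 1 := by
      rw [← ENNReal.toReal_one]; exact ENNReal.toReal_mono ENNReal.one_ne_top hM1
    simp [max_eq_left this]

theorem phiLog_div_le {P μ w B lam b : ℝ} (hP : 1 ≤ P) (hμ : 0 ≤ μ) (hw : 0 ≤ w) (hB : 0 < B)
    (hlam : 0 < lam) (hb1 : 1 ≤ b) (hb : Real.log (w ^ P / lam) ≤ b) (hlB : lam ≤ B ^ P) :
    phiLog P μ (w / B) ≤ 2 ^ μ / B ^ P * (b ^ μ * w ^ P) := by
  have hexp : w / B ≤ Real.exp b := by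
    rcases le_or_gt (w / B) 1 with h | h
    · exact h.trans (Real.one_le_exp (by linarith))
    · have hpos : 0 < w / B := by linarith
      rw [← Real.log_le_iff_le_exp hpos]
      calc Real.log (w / B) ≤ P * Real.log (w / B) :=
            le_mul_of_one_le_left (Real.log_nonneg h.le) hP
        _ = Real.log ((w / B) ^ P) := (Real.log_rpow hpos P).symm
        _ ≤ Real.log (w ^ P / lam) := by
            apply Real.log_le_log (by positivity)
            rw [Real.div_rpow hw hB.le]
            have := Real.rpow_nonneg hw P
            gcongr
        _ ≤ b := hb
  have hlog : Real.log (Real.exp 1 + w / B) ≤ 2 * b := by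
    rw [Real.log_le_iff_le_exp (by positivity), two_mul, Real.exp_add]
    have h1 : Real.exp 1 ≤ Real.exp b := Real.exp_le_exp.2 hb1
    have h2 : 2 ≤ Real.exp b := by linarith [Real.add_one_le_exp b]
    nlinarith
  have hlog0 : 0 ≤ Real.log (Real.exp 1 + w / B) := by
    apply Real.log_nonneg
    have : 0 ≤ w / B := by positivity
    linarith [Real.add_one_le_exp 1]
  calc phiLog P μ (w / B) ≤ (w / B) ^ P * (2 * b) ^ μ := by
        unfold phiLog
        gcongr
    _ = 2 ^ μ / B ^ P * (b ^ μ * w ^ P) := by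
        rw [Real.div_rpow hw hB.le, Real.mul_rpow (by norm_num) (by linarith)]
        ring

theorem phiLog_zero {P μ : ℝ} (hP : P ≠ 0) : phiLog P μ 0 = 0 := by
  simp [phiLog, Real.zero_rpow hP]

/-- The scalar inequality extracting the bump bound from the tested weak type inequality. -/
theorem bump_scalar_bound {p κ V J U U' E D : ℝ} (m : ℕ) (hp : 1 < p) (hκ : 0 < κ) (hV : 0 < V)
    (hJ : 0 < J) (hU : 0 < U) (hU' : 0 ≤ U') (hE : 0 < E) (hD : 0 < D)
    (h : κ / V / 2 * J * U' ^ (1 / p) ≤ E * J ^ (1 / p)) (hUD : U ≤ D * U') :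
    2 ^ ((m : ℝ) * (p / (p - 1))) * J ≤
      V * (2 ^ m * (2 * E / κ * D ^ (1 / p)) * (V / U) ^ (1 / p)) ^ (p / (p - 1)) := by
  have hp0 : 0 < p := by linarith
  have hp1 : 0 < p - 1 := by linarith
  set P := p / (p - 1) with hP
  have hP0 : 0 < P := by positivity
  set T := 2 * E / κ * D ^ (1 / p) with hT
  have hT0 : 0 < T := by positivity
  have hU1 : U ^ (1 / p) ≤ D ^ (1 / p) * U' ^ (1 / p) := by
    rw [← Real.mul_rpow hD.le hU']
    exact Real.rpow_le_rpow hU.le hUD (by positivity)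
  have hJsplit : J = J ^ (1 / P) * J ^ (1 / p) := by
    rw [← Real.rpow_add hJ, hP]
    have : 1 / (p / (p - 1)) + 1 / p = 1 := by field_simp; ring
    rw [this, Real.rpow_one]
  have hJp : 0 < J ^ (1 / p) := by positivity
  have hkey : J ^ (1 / P) ≤ T * V / U ^ (1 / p) := by
    rw [le_div_iff₀ (by positivity)]
    refine le_of_mul_le_mul_right ?_ hJp
    calc J ^ (1 / P) * U ^ (1 / p) * J ^ (1 / p) = J * U ^ (1 / p) := by
          conv_rhs => rw [hJsplit]
          ring
      _ ≤ J * (D ^ (1 / p) * U' ^ (1 / p)) := by gcongr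
      _ = 2 * V / κ * D ^ (1 / p) * (κ / V / 2 * J * U' ^ (1 / p)) := by
          field_simp
      _ ≤ 2 * V / κ * D ^ (1 / p) * (E * J ^ (1 / p)) := by gcongr
      _ = T * V * J ^ (1 / p) := by rw [hT]; ring
  have hJle : J ≤ (T * V / U ^ (1 / p)) ^ P := by
    calc J = (J ^ (1 / P)) ^ P := by
          rw [← Real.rpow_mul hJ.le, one_div_mul_cancel hP0.ne', Real.rpow_one]
      _ ≤ _ := Real.rpow_le_rpow (by positivity) hkey hP0.le
  have hVs : V ^ P = V * (V ^ (1 / p)) ^ P := by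
    rw [← Real.rpow_mul hV.le]
    nth_rewrite 2 [← Real.rpow_one V]
    rw [← Real.rpow_add hV]
    congr 1
    rw [hP]; field_simp; ring
  clear_value T P
  calc 2 ^ ((m : ℝ) * P) * J ≤ 2 ^ ((m : ℝ) * P) * (T * V / U ^ (1 / p)) ^ P := by gcongr
    _ = V * (2 ^ m * T * (V / U) ^ (1 / p)) ^ P := by
        rw [Real.div_rpow (by positivity) (by positivity), Real.div_rpow hV.le hU.le,
          Real.mul_rpow hT0.le hV.le, Real.mul_rpow (x := 2 ^ m * T) (by positivity) (by positivity),
          Real.mul_rpow (x := (2 : ℝ) ^ m) (by positivity) hT0.le,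
          Real.div_rpow (by positivity) (by positivity),
          hVs, Real.rpow_mul (by norm_num), Real.rpow_natCast]
        ring

/-- The dual test function does not increase the weighted norm. -/
theorem lpNormR_indicator_le {n m : ℕ} {p : ℝ} (hp : 1 < p) {v b W : (Fin n → ℝ) → ℝ} (Q : Cube n)
    (hb0 : ∀ x, 0 ≤ b x) (hW0 : ∀ x, 0 ≤ W x) (hWv : ∀ x, W x ^ p * v x ≤ 1) :
    lpNormR p v (Q.set.indicator fun x =>
        b x ^ ((m : ℝ) * (p / (p - 1) - 1)) * W x ^ (p / (p - 1))) ≤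
      (∫⁻ x in Q.set, ENNReal.ofReal
        (b x ^ ((m : ℝ) * (p / (p - 1))) * W x ^ (p / (p - 1)))) ^ (1 / p) := by
  have hp0 : 0 < p := by linarith
  have hp1 : 0 < p - 1 := by linarith
  set P := p / (p - 1) with hP
  have hP0 : 0 < P := by positivity
  refine ENNReal.rpow_le_rpow ?_ (by positivity)
  rw [← lintegral_indicator Q.measurableSet_set]
  refine lintegral_mono fun x => ?_
  by_cases hx : x ∈ Q.set
  · simp only [Set.indicator_of_mem hx]
    have hg0 : 0 ≤ b x ^ ((m : ℝ) * (P - 1)) * W x ^ P :=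
      mul_nonneg (Real.rpow_nonneg (hb0 x) _) (Real.rpow_nonneg (hW0 x) _)
    rw [abs_of_nonneg hg0, ENNReal.ofReal_rpow_of_nonneg hg0 hp0.le,
      ← ENNReal.ofReal_mul (by positivity)]
    apply ENNReal.ofReal_le_ofReal
    rw [Real.mul_rpow (Real.rpow_nonneg (hb0 x) _) (Real.rpow_nonneg (hW0 x) _),
      ← Real.rpow_mul (hb0 x), ← Real.rpow_mul (hW0 x),
      show (m : ℝ) * (P - 1) * p = m * P by rw [hP]; field_simp; ring,
      show P * p = P + p by rw [hP]; field_simp; ring,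
      Real.rpow_add_of_nonneg (hW0 x) hP0.le hp0.le]
    have h1 := Real.rpow_nonneg (hb0 x) ((m : ℝ) * P)
    have h2 := Real.rpow_nonneg (hW0 x) P
    calc b x ^ ((m : ℝ) * P) * (W x ^ P * W x ^ p) * v x
        = b x ^ ((m : ℝ) * P) * W x ^ P * (W x ^ p * v x) := by ring
      _ ≤ b x ^ ((m : ℝ) * P) * W x ^ P * 1 :=
          mul_le_mul_of_nonneg_left (hWv x) (mul_nonneg h1 h2)
      _ = _ := mul_one _
  · simp [Set.indicator_of_notMem hx, ENNReal.zero_rpow_of_pos hp0]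

/-- The weak type inequality for all symbols bounds the logarithmic integral of a truncation. -/
theorem lintegral_phiLog_le_volume {n m : ℕ} (hn : n ≠ 0) {p : ℝ} (hp : 1 < p)
    {K : (Fin n → ℝ) → (Fin n → ℝ) → ℝ} (hcont : ∀ x, ContinuousOn (K x) {x}ᶜ)
    {u v : (Fin n → ℝ) → ℝ} {C : ℝ}
    (hbound : ∀ b : (Fin n → ℝ) → ℝ, LocallyIntegrable b volume → bmoNorm b < ⊤ →
      ∀ f : (Fin n → ℝ) → ℝ, Measurable f → (∃ M : ℝ, ∀ x, |f x| ≤ M) →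
        HasCompactSupport f →
        weakLpNorm p u (Set.indicator (tsupport f)ᶜ (commFn m K b f)) ≤
          ENNReal.ofReal C * bmoNorm b ^ m * lpNormR p v f)
    {Q Q' : Cube n}
    (hfar : ∀ x ∈ Q'.set, (1 / 2 + Real.exp 1 * 2 ^ n) * Q.side ≤ dist x Q.center)
    {ε κ : ℝ} (hκ : 0 < κ) (hε : |ε| = 1)
    (hK : ∀ x ∈ Q'.set, ∀ y ∈ Metric.closedBall Q.center (Q.side / 2),
      κ / Q.side ^ n ≤ ε * K x y)
    {U U' D E : ℝ} (hU : 0 < U) (hU' : 0 ≤ U')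
    (hu' : ∫⁻ x in Q'.set, ENNReal.ofReal (u x) = ENNReal.ofReal U') (hD : 0 < D)
    (hUD : U ≤ D * U') (hE : 0 < E)
    (hCE : ENNReal.ofReal C * logMaxConst n ^ m ≤ ENNReal.ofReal E)
    {W : (Fin n → ℝ) → ℝ} (hWm : Measurable W) (hW0 : ∀ x, 0 ≤ W x) {N : ℝ}
    (hWN : ∀ x, W x ≤ N) (hWv : ∀ x, W x ^ p * v x ≤ 1) :
    ∫⁻ x in Q.set, ENNReal.ofReal (phiLog (p / (p - 1)) ((m : ℝ) * (p / (p - 1)))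
      (W x / (2 ^ m * (2 * E / κ * D ^ (1 / p)) * (Q.side ^ n / U) ^ (1 / p)))) ≤
      volume Q.set := by
  have hl := Q.side_pos
  have hp0 : 0 < p := by linarith
  have hp1 : 0 < p - 1 := by linarith
  set P := p / (p - 1) with hP
  have hP0 : 0 < P := by positivity
  have hP1 : 1 ≤ P := by rw [hP, one_le_div hp1]; linarith
  set B := 2 ^ m * (2 * E / κ * D ^ (1 / p)) * (Q.side ^ n / U) ^ (1 / p) with hB
  have hB0 : 0 < B := by positivity
  have hσm : Measurable fun x => W x ^ P := hWm.pow_const P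
  have hσ0 : ∀ x, 0 ≤ W x ^ P := fun x => Real.rpow_nonneg (hW0 x) P
  have hσN : ∀ x, W x ^ P ≤ N ^ P := fun x => Real.rpow_le_rpow (hW0 x) (hWN x) hP0.le
  have hσint := integrableOn_cube_of_bounded Q hσm hσ0 hσN
  rcases (setIntegral_nonneg Q.measurableSet_set fun x _ => hσ0 x).eq_or_lt with hI | hI
  · rw [eq_comm, integral_eq_zero_iff_of_nonneg (fun x => hσ0 x) hσint] at hI
    rw [lintegral_congr_ae (g := fun _ => 0)]
    · simp
    · filter_upwards [hI] with x hx
      have hWx : W x = 0 := (Real.rpow_eq_zero (hW0 x) hP0.ne').1 hx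
      rw [hWx, zero_div, phiLog_zero hP0.ne', ENNReal.ofReal_zero]
  obtain ⟨b, lam, hlam, hlamI, hbm, hb0, ⟨M, hbM⟩, hbloc, hbbmo, hb1, hblog, hbfar⟩ :=
    exists_log_symbol hn Q hσm hσ0 hσN hI
  set g : (Fin n → ℝ) → ℝ := fun x => b x ^ ((m : ℝ) * (P - 1)) * W x ^ P with hg
  have hgm : Measurable g := (hbm.pow_const _).mul hσm
  have hmP : 0 ≤ (m : ℝ) * (P - 1) := mul_nonneg (Nat.cast_nonneg m) (by linarith)
  have hg0 : ∀ x, 0 ≤ g x := fun x => mul_nonneg (Real.rpow_nonneg (hb0 x) _) (hσ0 x)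
  have hM0 : 0 ≤ M := (hb0 Q.center).trans (hbM Q.center)
  have hgM : ∀ x, g x ≤ M ^ ((m : ℝ) * (P - 1)) * N ^ P := fun x =>
    mul_le_mul (Real.rpow_le_rpow (hb0 x) (hbM x) hmP) (hσN x) (hσ0 x) (by positivity)
  have hbg : ∀ x, b x ^ m * g x = b x ^ ((m : ℝ) * P) * W x ^ P := by
    intro x
    rw [hg, ← mul_assoc, ← Real.rpow_natCast (b x) m,
      ← Real.rpow_add_of_nonneg (hb0 x) (Nat.cast_nonneg m) hmP]
    congr 2
    ring
  have hbg0 : ∀ x, 0 ≤ b x ^ m * g x := fun x => mul_nonneg (pow_nonneg (hb0 x) m) (hg0 x)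
  have hbgM : ∀ x, b x ^ m * g x ≤ M ^ m * (M ^ ((m : ℝ) * (P - 1)) * N ^ P) := fun x =>
    mul_le_mul (pow_le_pow_left₀ (hb0 x) (hbM x) m) (hgM x) (hg0 x) (by positivity)
  have hbgint : IntegrableOn (fun x => b x ^ m * g x) Q.set volume :=
    integrableOn_cube_of_bounded Q ((hbm.pow_const m).mul hgm) hbg0 hbgM
  set J := ∫ y in Q.set, b y ^ m * g y with hJdef
  have hIJ : ∫ x in Q.set, W x ^ P ≤ J := by
    refine setIntegral_mono_on hσint hbgint Q.measurableSet_set fun x hx => ?_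
    rw [hbg]
    exact le_mul_of_one_le_left (hσ0 x) (Real.one_le_rpow (hb1 x hx) (by positivity))
  have hJ : 0 < J := hI.trans_le hIJ
  have hJlint : ∫⁻ x in Q.set, ENNReal.ofReal (b x ^ ((m : ℝ) * P) * W x ^ P) =
      ENNReal.ofReal J := by
    rw [hJdef, ofReal_integral_eq_lintegral_ofReal hbgint (ae_of_all _ hbg0)]
    simp_rw [hbg]
  have htest : κ / Q.side ^ n / 2 * J * U' ^ (1 / p) ≤ E * J ^ (1 / p) := by
    have hlow := le_weakLpNorm_commFn hp hcont (Q := Q) (Q' := Q') (fun x hx hc => by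
      have h := (hfar x hx).trans (Metric.mem_closedBall.1 hc)
      have : 0 < Real.exp 1 * 2 ^ n * Q.side := by positivity
      linarith) (by positivity : 0 < κ / Q.side ^ n) hε hK
      (fun x hx => hbfar x (hfar x hx)) hb0 hbm hgm hg0 hbgM hJ u
    have hup := hbound b hbloc (hbbmo.trans_lt (logMaxConst_ne_top n).lt_top)
      (Q.set.indicator g) (hgm.indicator Q.measurableSet_set)
      ⟨M ^ ((m : ℝ) * (P - 1)) * N ^ P, fun x => by
        rw [abs_of_nonneg (Set.indicator_nonneg (fun x _ => hg0 x) x)]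
        exact (Set.indicator_le_self' (fun x _ => hg0 x) x).trans (hgM x)⟩
      ((isCompact_closedBall _ _).of_isClosed_subset (isClosed_tsupport _)
        (tsupport_indicator_subset Q g))
    have hlp := lpNormR_indicator_le (m := m) hp Q hb0 hW0 hWv
    rw [← hP, hJlint, ENNReal.ofReal_rpow_of_nonneg hJ.le (by positivity)] at hlp
    rw [hu', ENNReal.ofReal_rpow_of_nonneg hU' (by positivity),
      ← ENNReal.ofReal_mul (by positivity)] at hlow
    have h : ENNReal.ofReal (κ / Q.side ^ n / 2 * J * U' ^ (1 / p)) ≤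
        ENNReal.ofReal (E * J ^ (1 / p)) := by
      rw [ENNReal.ofReal_mul hE.le]
      refine hlow.trans (hup.trans (mul_le_mul' (le_trans ?_ hCE) hlp))
      gcongr
    exact (ENNReal.ofReal_le_ofReal_iff (by positivity)).1 h
  have hscalar := bump_scalar_bound m hp hκ (pow_pos hl n) hJ hU hU' hE hD htest hUD
  rw [← hP, ← hB] at hscalar
  have hlamB : lam ≤ B ^ P := by
    have h2 : (1 : ℝ) ≤ 2 ^ ((m : ℝ) * P) := Real.one_le_rpow (by norm_num) (by positivity)
    have h3 : J ≤ 2 ^ ((m : ℝ) * P) * J := le_mul_of_one_le_left hJ.le h2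
    refine le_of_mul_le_mul_right ?_ (pow_pos hl n)
    linarith
  calc ∫⁻ x in Q.set, ENNReal.ofReal (phiLog P ((m : ℝ) * P) (W x / B))
      ≤ ∫⁻ x in Q.set, ENNReal.ofReal (2 ^ ((m : ℝ) * P) / B ^ P) *
          ENNReal.ofReal (b x ^ ((m : ℝ) * P) * W x ^ P) := by
        refine setLIntegral_mono_ae' Q.measurableSet_set ?_
        filter_upwards [hblog] with x hx hxQ
        rw [← ENNReal.ofReal_mul (by positivity)]
        exact ENNReal.ofReal_le_ofReal
          (phiLog_div_le hP1 (by positivity) (hW0 x) hB0 hlam (hb1 x hxQ) (hx hxQ) hlamB)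
    _ = ENNReal.ofReal (2 ^ ((m : ℝ) * P) / B ^ P) * ENNReal.ofReal J := by
        rw [lintegral_const_mul' _ _ ENNReal.ofReal_ne_top, hJlint]
    _ = ENNReal.ofReal (2 ^ ((m : ℝ) * P) * J / B ^ P) := by
        rw [← ENNReal.ofReal_mul (by positivity)]
        congr 1; ring
    _ ≤ volume Q.set := by
        rw [Q.volume_set]
        apply ENNReal.ofReal_le_ofReal
        rw [div_le_iff₀ (by positivity)]
        exact hscalar

theorem luxNorm_le_ofReal {n : ℕ} {φ : ℝ → ℝ} {S : Set (Fin n → ℝ)} {f : (Fin n → ℝ) → ℝ} {c : ℝ}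
    (hc : 0 < c) (h : ∫⁻ x in S, ENNReal.ofReal (φ (|f x| / c)) ≤ volume S) :
    luxNorm φ S f ≤ ENNReal.ofReal c :=
  sInf_le ⟨c, hc, rfl, h⟩

theorem lintegral_rpow_one_div {n : ℕ} {p : ℝ} (hp : 0 < p) {u : (Fin n → ℝ) → ℝ}
    (hu : ∀ x, 0 ≤ u x) (S : Set (Fin n → ℝ)) {c : ℝ} (hc : 0 < c) :
    ∫⁻ x in S, ENNReal.ofReal ((|u x ^ (1 / p)| / c) ^ p) =
      ENNReal.ofReal (1 / c ^ p) * ∫⁻ x in S, ENNReal.ofReal (u x) := by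
  rw [← lintegral_const_mul' _ _ ENNReal.ofReal_ne_top]
  congr 1; ext x
  rw [← ENNReal.ofReal_mul (by positivity), abs_of_nonneg (Real.rpow_nonneg (hu x) _),
    Real.div_rpow (Real.rpow_nonneg (hu x) _) hc.le, ← Real.rpow_mul (hu x),
    one_div_mul_cancel hp.ne', Real.rpow_one]
  congr 1; ring

theorem luxNorm_rpow_eq_zero {n : ℕ} {p : ℝ} (hp : 0 < p) {u : (Fin n → ℝ) → ℝ}
    (hu : ∀ x, 0 ≤ u x) {S : Set (Fin n → ℝ)} (h : ∫⁻ x in S, ENNReal.ofReal (u x) = 0) :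
    luxNorm (fun t => t ^ p) S (fun x => u x ^ (1 / p)) = 0 := by
  refine le_antisymm (ENNReal.le_of_forall_pos_le_add fun e he _ => ?_) bot_le
  rw [zero_add, ← ENNReal.ofReal_coe_nnreal]
  refine luxNorm_le_ofReal he ?_
  rw [lintegral_rpow_one_div hp hu S (NNReal.coe_pos.2 he), h, mul_zero]
  exact bot_le

theorem luxNorm_rpow_le {n : ℕ} {p : ℝ} (hp : 0 < p) {u : (Fin n → ℝ) → ℝ}
    (hu : ∀ x, 0 ≤ u x) (Q : Cube n) {U : ℝ} (hU : 0 < U)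
    (h : ∫⁻ x in Q.set, ENNReal.ofReal (u x) = ENNReal.ofReal U) :
    luxNorm (fun t => t ^ p) Q.set (fun x => u x ^ (1 / p)) ≤
      ENNReal.ofReal ((U / Q.side ^ n) ^ (1 / p)) := by
  have hl := Q.side_pos
  refine luxNorm_le_ofReal (by positivity) ?_
  rw [lintegral_rpow_one_div hp hu _ (by positivity), h, ← ENNReal.ofReal_mul (by positivity),
    ← Real.rpow_mul (by positivity), one_div_mul_cancel hp.ne', Real.rpow_one, Q.volume_set]
  apply ENNReal.ofReal_le_ofReal
  field_simp
  exact le_rfl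

/-- A Luxemburg norm bound passes from the truncations of a nonnegative function to itself. -/
theorem luxNorm_le_of_truncation {n : ℕ} {φ : ℝ → ℝ} (hφ : Measurable φ) {S : Set (Fin n → ℝ)}
    {w : (Fin n → ℝ) → ℝ} (hwm : Measurable w) (hw : ∀ x, 0 ≤ w x) {c : ℝ} (hc : 0 < c)
    (h : ∀ N : ℕ, ∫⁻ x in S, ENNReal.ofReal (φ (min (w x) N / c)) ≤ volume S) :
    luxNorm φ S w ≤ ENNReal.ofReal c := by
  refine luxNorm_le_ofReal hc ?_
  have hlim : ∀ x, Tendsto (fun N : ℕ => ENNReal.ofReal (φ (min (w x) N / c))) atTop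
      (nhds (ENNReal.ofReal (φ (|w x| / c)))) := by
    intro x
    apply tendsto_const_nhds.congr'
    obtain ⟨N₀, hN₀⟩ := exists_nat_ge (w x)
    filter_upwards [eventually_ge_atTop N₀] with N hN
    rw [min_eq_left (hN₀.trans (Nat.cast_le.2 hN)), abs_of_nonneg (hw x)]
  calc ∫⁻ x in S, ENNReal.ofReal (φ (|w x| / c))
      = ∫⁻ x in S, liminf (fun N : ℕ => ENNReal.ofReal (φ (min (w x) N / c))) atTop := by
        congr 1; ext x
        rw [(hlim x).liminf_eq]
    _ ≤ liminf (fun N : ℕ => ∫⁻ x in S, ENNReal.ofReal (φ (min (w x) N / c))) atTop :=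
        lintegral_liminf_le fun N =>
          (hφ.comp ((hwm.min measurable_const).div_const c)).ennreal_ofReal
    _ ≤ volume S := liminf_le_of_le (by isBoundedDefault) fun a ha => by
        obtain ⟨N, hN⟩ := ha.exists
        exact hN.trans (h N)

theorem measurable_phiLog (q a : ℝ) : Measurable (phiLog q a) :=
  (measurable_id.pow_const q).mul
    ((Real.measurable_log.comp (measurable_const.add measurable_id)).pow_const a)

theorem lintegral_cube_ne_top {n : ℕ} {u : (Fin n → ℝ) → ℝ} (hu : IsWeight u) (Q : Cube n) :
    ∫⁻ x in Q.set, ENNReal.ofReal (u x) ≠ ⊤ := by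
  have h : IntegrableOn u Q.set volume :=
    (hu.2.2.integrableOn_isCompact (isCompact_closedBall Q.center (Q.side / 2))).mono_set
      Q.set_subset_closedBall
  rw [← ofReal_integral_eq_lintegral_ofReal h (ae_of_all _ hu.2.1)]
  exact ENNReal.ofReal_ne_top

/-- **Theorem (necessary bump condition for the boundedness of iterated commutators).** -/
theorem necessary_bump_condition (n : ℕ) (m : ℕ) (p : ℝ) (hp : 1 < p)
    (K : (Fin n → ℝ) → (Fin n → ℝ) → ℝ) (CK : ℝ) (hsize : KernelSize K CK)
    (ω : ℝ → ℝ) (hω0 : ∀ t, 0 ≤ ω t)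
    (hωlim : Tendsto ω (nhdsWithin 0 (Set.Ioi 0)) (nhds 0))
    (hsmooth : KernelSmooth K ω)
    (c₀ : ℝ) (hc₀ : 0 < c₀) (hnd : KernelNonDeg K c₀)
    (hnd' : KernelNonDeg (fun x y => K y x) c₀)
    (u v : (Fin n → ℝ) → ℝ) (hu : IsWeight u) (hv : IsWeight v)
    (hdoub : IsDoublingWeight u)
    (C : ℝ)
    (hbound : ∀ b : (Fin n → ℝ) → ℝ, LocallyIntegrable b volume → bmoNorm b < ⊤ →
      ∀ f : (Fin n → ℝ) → ℝ, Measurable f → (∃ M : ℝ, ∀ x, |f x| ≤ M) →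
        HasCompactSupport f →
        weakLpNorm p u (Set.indicator (tsupport f)ᶜ (commFn m K b f)) ≤
          ENNReal.ofReal C * bmoNorm b ^ m * lpNormR p v f) :
    (⨆ Q : Cube n,
      luxNorm (fun t => t ^ p) Q.set (fun x => u x ^ (1 / p)) *
        luxNorm (phiLog (p / (p - 1)) ((m : ℝ) * (p / (p - 1)))) Q.set
          (fun x => v x ^ (-(1 / p)))) < ⊤ := by
  have hp0 : 0 < p := by linarith
  have hn : n ≠ 0 := by
    rintro rfl
    obtain ⟨x, hx, -⟩ := hnd 0 1 one_pos
    exact hx (by rw [Subsingleton.elim x 0]; exact Metric.mem_ball_self one_pos)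
  obtain ⟨κ, hκ, R, hker⟩ := exists_kernel_lower_bound hn hsize hωlim hsmooth hc₀ hnd
    (1 + Real.exp 1 * 2 ^ n)
  obtain ⟨D, hD, hdouble⟩ := hdoub.exists_le R
  set E := (ENNReal.ofReal C * logMaxConst n ^ m).toReal + 1 with hE_def
  have hE : 0 < E := by positivity
  have hCE : ENNReal.ofReal C * logMaxConst n ^ m ≤ ENNReal.ofReal E := by
    rw [ENNReal.le_ofReal_iff_toReal_le (ENNReal.mul_ne_top ENNReal.ofReal_ne_top
      (ENNReal.pow_ne_top (logMaxConst_ne_top n))) hE.le, hE_def]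
    linarith
  set T := 2 ^ m * (2 * E / κ * D ^ (1 / p)) with hT
  have hT0 : 0 < T := by positivity
  refine (iSup_le fun Q => ?_).trans_lt (ENNReal.ofReal_lt_top (r := T))
  have hl := Q.side_pos
  rcases eq_or_ne (∫⁻ x in Q.set, ENNReal.ofReal (u x)) 0 with h0 | h0
  · rw [luxNorm_rpow_eq_zero hp0 hu.2.1 h0, zero_mul]
    exact bot_le
  obtain ⟨x₀, hfar, hnear, ε, hε, hK⟩ := hker Q.center Q.side hl
  set Q' := Cube.ofCenter x₀ Q.side hl with hQ'
  have hcenter : Q'.center = x₀ := Cube.center_ofCenter _ _ _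
  have hQ'sub : Q'.set ⊆ Metric.closedBall x₀ (Q.side / 2) := by
    rw [← hcenter]; exact Q'.set_subset_closedBall
  have huQ := lintegral_cube_ne_top hu Q
  have huQ' := lintegral_cube_ne_top hu Q'
  have hU : 0 < (∫⁻ x in Q.set, ENNReal.ofReal (u x)).toReal := ENNReal.toReal_pos h0 huQ
  have hUD : (∫⁻ x in Q.set, ENNReal.ofReal (u x)).toReal ≤
      D * (∫⁻ x in Q'.set, ENNReal.ofReal (u x)).toReal := by
    have h := ENNReal.toReal_mono (ENNReal.mul_ne_top ENNReal.ofReal_ne_top huQ')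
      (hdouble Q Q' rfl (by rw [hcenter]; exact hnear))
    rwa [ENNReal.toReal_mul, ENNReal.toReal_ofReal hD.le] at h
  set U := (∫⁻ x in Q.set, ENNReal.ofReal (u x)).toReal with hU_def
  have hw : ∀ x, 0 ≤ v x ^ (-(1 / p)) := fun x => Real.rpow_nonneg (hv.2.1 x) _
  have hwm : Measurable fun x => v x ^ (-(1 / p)) := hv.1.pow_const _
  have hlux := luxNorm_le_of_truncation
    (measurable_phiLog (p / (p - 1)) ((m : ℝ) * (p / (p - 1)))) (S := Q.set) hwm hw
    (c := T * (Q.side ^ n / U) ^ (1 / p)) (by positivity) fun N =>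
      lintegral_phiLog_le_volume hn hp (continuousOn_kernel hωlim hsmooth) hbound
        (Q := Q) (Q' := Q') (fun x hx => by
          have h1 := Metric.mem_closedBall.1 (hQ'sub hx)
          have h2 := dist_triangle x₀ x Q.center
          rw [dist_comm x₀ x] at h2
          linarith) hκ hε (fun x hx => hK x (hQ'sub hx)) hU ENNReal.toReal_nonneg
        (ENNReal.ofReal_toReal huQ').symm hD hUD hE hCE
        (W := fun x => min (v x ^ (-(1 / p))) N) (hwm.min measurable_const)
        (fun x => le_min (hw x) (Nat.cast_nonneg N)) (fun x => min_le_right _ _)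
        (fun x => by
          rcases (hv.2.1 x).eq_or_lt with hvx | hvx
          · rw [← hvx, mul_zero]; exact zero_le_one
          · calc min (v x ^ (-(1 / p))) N ^ p * v x
                ≤ (v x ^ (-(1 / p))) ^ p * v x := by
                  gcongr
                  exact min_le_left _ _
              _ = 1 := by
                  rw [← Real.rpow_mul hvx.le, neg_mul, one_div_mul_cancel hp0.ne',
                    Real.rpow_neg_one, inv_mul_cancel₀ hvx.ne'])
  calc _ ≤ ENNReal.ofReal ((U / Q.side ^ n) ^ (1 / p)) *
        ENNReal.ofReal (T * (Q.side ^ n / U) ^ (1 / p)) :=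
        mul_le_mul' (luxNorm_rpow_le hp0 hu.2.1 Q hU (ENNReal.ofReal_toReal huQ).symm) hlux
    _ = ENNReal.ofReal T := by
        rw [← ENNReal.ofReal_mul (by positivity), mul_left_comm,
          ← Real.mul_rpow (by positivity) (by positivity),
          div_mul_div_cancel₀ (by positivity), div_self hU.ne', Real.one_rpow, mul_one]

end
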